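/- For every ℓ > 0 and M > 0 there exists a constant C = C(ℓ,M) > 0 with the following property: let u, ǔ : ℝ × ℝ → ℝ³ be smooth maps, ℓ-periodic in the second variable, with |u| = |ǔ| = 1 everywhere, both solving ∂ₜu = ∂ₛ(u × ∂ₛu) and ∂ₜǔ = ∂ₛ(ǔ × ∂ₛǔ), and set w := u − ǔ. Then for every t ∈ ℝ such that ‖∂ₛₛₛu(t,·)‖₂ ≤ M and ‖∂ₛₛₛǔ(t,·)‖₂ ≤ M, one has at time t: (d/dt)‖w‖₂² ≤ C·(‖w‖₂² + ‖∂ₛw‖₂²); (d/dt)‖∂ₛw‖₂² ≤ C·(‖w‖₂² + ‖∂ₛw‖₂²); and (d/dt)(‖∂ₛₛw‖₂² + ‖∂ₜw‖₂²) ≤ C·(‖∂ₛₛw‖₂² + ‖∂ₜw‖₂²), where all norms are L² norms in s over one period [0,ℓ] evaluated at time t. -/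

import Mathlib

noncomputable section
open Real MeasureTheory

/-- `ℝ³` as Euclidean space. -/
abbrev R3 : Type := EuclideanSpace ℝ (Fin 3)

/-- Pack three real numbers into a vector of `ℝ³`. -/
def toE (v : Fin 3 → ℝ) : R3 := (EuclideanSpace.equiv (Fin 3) ℝ).symm v

/-- The cross product on `ℝ³`. -/
def cross3 (a b : R3) : R3 :=
  toE ![a 1 * b 2 - a 2 * b 1, a 2 * b 0 - a 0 * b 2, a 0 * b 1 - a 1 * b 0]



/-! ### Algebra of the cross product -/

lemma inner3 (a b : R3) : inner ℝ a b = a 0 * b 0 + a 1 * b 1 + a 2 * b 2 := by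
  simp [PiLp.inner_apply, Fin.sum_univ_three]; ring

lemma norm3 (a : R3) : ‖a‖ ^ 2 = a 0 * a 0 + a 1 * a 1 + a 2 * a 2 := by
  rw [← real_inner_self_eq_norm_sq, inner3]

lemma cross3_0 (a b : R3) : cross3 a b 0 = a 1 * b 2 - a 2 * b 1 := rfl
lemma cross3_1 (a b : R3) : cross3 a b 1 = a 2 * b 0 - a 0 * b 2 := rfl
lemma cross3_2 (a b : R3) : cross3 a b 2 = a 0 * b 1 - a 1 * b 0 := rfl

lemma ext3 {a b : R3} (h0 : a 0 = b 0) (h1 : a 1 = b 1) (h2 : a 2 = b 2) : a = b := by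
  ext i; fin_cases i <;> assumption

lemma cross_lagrange (a b : R3) :
    ‖cross3 a b‖ ^ 2 + (inner ℝ a b) ^ 2 = ‖a‖ ^ 2 * ‖b‖ ^ 2 := by
  simp only [norm3, inner3, cross3_0, cross3_1, cross3_2]; ring

lemma norm_cross_le (a b : R3) : ‖cross3 a b‖ ≤ ‖a‖ * ‖b‖ := by
  have := cross_lagrange a b
  apply (pow_le_pow_iff_left₀ (norm_nonneg _) (by positivity) two_ne_zero).1
  nlinarith [sq_nonneg (inner ℝ a b)]

/-- Cross product as a continuous bilinear map. -/
def crossL : R3 →L[ℝ] R3 →L[ℝ] R3 :=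
  LinearMap.mkContinuous₂
    (LinearMap.mk₂ ℝ cross3
      (by intros; apply ext3 <;> simp [cross3_0, cross3_1, cross3_2] <;> ring)
      (by intros; apply ext3 <;> simp [cross3_0, cross3_1, cross3_2] <;> ring)
      (by intros; apply ext3 <;> simp [cross3_0, cross3_1, cross3_2] <;> ring)
      (by intros; apply ext3 <;> simp [cross3_0, cross3_1, cross3_2] <;> ring)) 1
    (by intro a b; simpa using norm_cross_le a b)

lemma crossL_apply (a b : R3) : crossL a b = cross3 a b := rfl

lemma HasDerivAt.cross {f g : ℝ → R3} {f' g' : R3} {x : ℝ} (hf : HasDerivAt f f' x)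
    (hg : HasDerivAt g g' x) :
    HasDerivAt (fun y => cross3 (f y) (g y)) (cross3 (f x) g' + cross3 f' (g x)) x :=
  crossL.hasDerivAt_of_bilinear (fun _ => hf) (fun _ => hg)

/-! ### Partial derivatives -/

section partials
variable {E : Type*} [NormedAddCommGroup E] [NormedSpace ℝ E]

/-- joint smoothness -/
def Sm (f : ℝ → ℝ → E) : Prop := ContDiff ℝ (⊤ : ℕ∞) (fun p : ℝ × ℝ => f p.1 p.2)

/-- space derivative -/
def dS (f : ℝ → ℝ → E) : ℝ → ℝ → E := fun t => deriv (f t)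

/-- time derivative -/
def dT (f : ℝ → ℝ → E) : ℝ → ℝ → E := fun t s => deriv (fun τ => f τ s) t

variable {f : ℝ → ℝ → E}

lemma Sm.hasFDerivAt (hf : Sm f) (p : ℝ × ℝ) :
    HasFDerivAt (fun p : ℝ × ℝ => f p.1 p.2) (fderiv ℝ (fun p : ℝ × ℝ => f p.1 p.2) p) p :=
  ((ContDiff.differentiable hf (by simp)) p).hasFDerivAt

lemma Sm.hS' (hf : Sm f) (t s : ℝ) :
    HasDerivAt (f t) (fderiv ℝ (fun p : ℝ × ℝ => f p.1 p.2) (t, s) (0, 1)) s := by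
  have h := (hf.hasFDerivAt (t, s)).comp_hasDerivAt s
    ((hasDerivAt_const s t).prodMk (hasDerivAt_id s))
  exact h

lemma Sm.hT' (hf : Sm f) (t s : ℝ) :
    HasDerivAt (fun τ => f τ s) (fderiv ℝ (fun p : ℝ × ℝ => f p.1 p.2) (t, s) (1, 0)) t := by
  have h := (hf.hasFDerivAt (t, s)).comp_hasDerivAt t
    ((hasDerivAt_id t).prodMk (hasDerivAt_const t s))
  exact h

lemma Sm.dS_eq (hf : Sm f) (t s : ℝ) :
    dS f t s = fderiv ℝ (fun p : ℝ × ℝ => f p.1 p.2) (t, s) (0, 1) := (hf.hS' t s).deriv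

lemma Sm.dT_eq (hf : Sm f) (t s : ℝ) :
    dT f t s = fderiv ℝ (fun p : ℝ × ℝ => f p.1 p.2) (t, s) (1, 0) := (hf.hT' t s).deriv

lemma Sm.hS (hf : Sm f) (t s : ℝ) : HasDerivAt (f t) (dS f t s) s := by
  rw [hf.dS_eq]; exact hf.hS' t s

lemma Sm.hT (hf : Sm f) (t s : ℝ) : HasDerivAt (fun τ => f τ s) (dT f t s) t := by
  rw [hf.dT_eq]; exact hf.hT' t s

lemma Sm.fd (hf : Sm f) : ContDiff ℝ (⊤ : ℕ∞) (fderiv ℝ (fun p : ℝ × ℝ => f p.1 p.2)) :=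
  ContDiff.fderiv_right hf (by simp)

lemma Sm.dS (hf : Sm f) : Sm (dS f) := by
  have : (fun p : ℝ × ℝ => _root_.dS f p.1 p.2) =
      fun p => fderiv ℝ (fun p : ℝ × ℝ => f p.1 p.2) p (0, 1) := by
    funext p; exact hf.dS_eq p.1 p.2
  unfold Sm; rw [this]
  exact hf.fd.clm_apply contDiff_const

lemma Sm.dT (hf : Sm f) : Sm (dT f) := by
  have : (fun p : ℝ × ℝ => _root_.dT f p.1 p.2) =
      fun p => fderiv ℝ (fun p : ℝ × ℝ => f p.1 p.2) p (1, 0) := by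
    funext p; exact hf.dT_eq p.1 p.2
  unfold Sm; rw [this]
  exact hf.fd.clm_apply contDiff_const

lemma Sm.comm (hf : Sm f) : _root_.dT (_root_.dS f) = _root_.dS (_root_.dT f) := by
  funext t s
  rw [hf.dS.dT_eq, hf.dT.dS_eq]
  have e1 : (fun p : ℝ × ℝ => _root_.dT f p.1 p.2) =
      fun p => fderiv ℝ (fun p : ℝ × ℝ => f p.1 p.2) p (1, 0) := by
    funext p; exact hf.dT_eq p.1 p.2
  have e2 : (fun p : ℝ × ℝ => _root_.dS f p.1 p.2) =
      fun p => fderiv ℝ (fun p : ℝ × ℝ => f p.1 p.2) p (0, 1) := by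
    funext p; exact hf.dS_eq p.1 p.2
  rw [e1, e2]
  have hd : DifferentiableAt ℝ (fderiv ℝ (fun p : ℝ × ℝ => f p.1 p.2)) (t, s) :=
    (hf.fd.differentiable (by simp)) _
  have hsym : IsSymmSndFDerivAt ℝ (fun p : ℝ × ℝ => f p.1 p.2) (t, s) :=
    ContDiffAt.isSymmSndFDerivAt (ContDiff.contDiffAt hf)
      (by simp only [minSmoothness_of_isRCLikeNormedField]; exact WithTop.coe_le_coe.2 le_top)
  rw [fderiv_clm_apply hd (by fun_prop), fderiv_clm_apply hd (by fun_prop)]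
  simpa using hsym.eq (1, 0) (0, 1)

lemma Sm.cont (hf : Sm f) (t : ℝ) : Continuous (f t) :=
  (ContDiff.continuous hf).comp (Continuous.prodMk_right t)

lemma per_dS {ℓ : ℝ} (h : ∀ t s, f t (s + ℓ) = f t s) (t s : ℝ) :
    dS f t (s + ℓ) = dS f t s := by
  have : (fun x => f t (x + ℓ)) = f t := by funext x; exact h t x
  unfold dS
  conv_rhs => rw [← this]
  rw [deriv_comp_add_const]

lemma per_dT {ℓ : ℝ} (h : ∀ t s, f t (s + ℓ) = f t s) (t s : ℝ) :
    dT f t (s + ℓ) = dT f t s := by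
  unfold dT; simp only [h]

lemma Sm.sub {g : ℝ → ℝ → E} (hf : Sm f) (hg : Sm g) : Sm (fun t s => f t s - g t s) :=
  ContDiff.sub hf hg

end partials

lemma leibniz {g : ℝ → ℝ → ℝ} (hg : Sm g) (ℓ t : ℝ) :
    HasDerivAt (fun τ => ∫ s in (0:ℝ)..ℓ, g τ s) (∫ s in (0:ℝ)..ℓ, dT g t s) t := by
  have hK : IsCompact (Set.Icc (t - 1) (t + 1) ×ˢ Set.uIcc (0:ℝ) ℓ) :=
    isCompact_Icc.prod isCompact_uIcc
  obtain ⟨B, hB⟩ := hK.exists_bound_of_continuousOn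
    (f := fun p : ℝ × ℝ => dT g p.1 p.2) (ContDiff.continuous hg.dT).continuousOn
  refine (intervalIntegral.hasDerivAt_integral_of_dominated_loc_of_deriv_le
    (s := Metric.ball t 1) (bound := fun _ => B) (F' := dT g) (Metric.ball_mem_nhds t one_pos)
    (Filter.Eventually.of_forall fun x => (hg.cont x).aestronglyMeasurable)
    ((hg.cont t).intervalIntegrable _ _) ((hg.dT.cont t).aestronglyMeasurable) ?_ (by simp) ?_).2
  · refine Filter.Eventually.of_forall fun s hs x hx => hB (x, s) ⟨?_, Set.uIoc_subset_uIcc hs⟩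
    rw [Metric.mem_ball, Real.dist_eq, abs_lt] at hx
    constructor <;> linarith [hx.1, hx.2]
  · exact Filter.Eventually.of_forall fun s hs x hx => hg.hT x s

/-! ### One-dimensional inequalities -/

lemma cs_int {g : ℝ → ℝ} (hg : Continuous g) {ℓ : ℝ} (hℓ : 0 < ℓ) :
    (∫ s in (0:ℝ)..ℓ, g s) ^ 2 ≤ ℓ * ∫ s in (0:ℝ)..ℓ, g s ^ 2 := by
  set I := ∫ s in (0:ℝ)..ℓ, g s with hI
  have h : 0 ≤ ∫ s in (0:ℝ)..ℓ, (ℓ * g s - I) ^ 2 :=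
    intervalIntegral.integral_nonneg hℓ.le fun s _ => sq_nonneg _
  have e : (∫ s in (0:ℝ)..ℓ, (ℓ * g s - I) ^ 2) =
      ℓ ^ 2 * (∫ s in (0:ℝ)..ℓ, g s ^ 2) - 2 * ℓ * I * I + I ^ 2 * ℓ := by
    have : (fun s => (ℓ * g s - I) ^ 2) =
        fun s => (ℓ ^ 2 * g s ^ 2 - (2 * ℓ * I) * g s) + I ^ 2 := by funext s; ring
    rw [this, intervalIntegral.integral_add, intervalIntegral.integral_sub,
      intervalIntegral.integral_const_mul, intervalIntegral.integral_const_mul, ← hI]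
    · simp; ring
    all_goals exact Continuous.intervalIntegrable (by fun_prop) _ _
  rw [e] at h
  have : 0 ≤ ℓ * (ℓ * (∫ s in (0:ℝ)..ℓ, g s ^ 2) - I ^ 2) := by nlinarith
  have := nonneg_of_mul_nonneg_right this hℓ
  linarith

section oneD
variable {E : Type*} [NormedAddCommGroup E] [NormedSpace ℝ E] [CompleteSpace E]
variable {g g' : ℝ → E} {ℓ : ℝ}

lemma osc (hℓ : 0 < ℓ) (h : ∀ s, HasDerivAt g (g' s) s) (hc : Continuous g') {s s' : ℝ}
    (hs : s ∈ Set.Icc 0 ℓ) (hs' : s' ∈ Set.Icc 0 ℓ) :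
    ‖g s - g s'‖ ≤ ∫ x in (0:ℝ)..ℓ, ‖g' x‖ := by
  rw [← intervalIntegral.integral_eq_sub_of_hasDerivAt (fun x _ => h x)
    (hc.intervalIntegrable _ _)]
  refine intervalIntegral.norm_integral_le_integral_norm_uIoc.trans ?_
  rw [intervalIntegral.integral_of_le hℓ.le]
  apply setIntegral_mono_set
  · exact (hc.norm.intervalIntegrable 0 ℓ).1
  · exact Filter.Eventually.of_forall fun x => norm_nonneg _
  · apply LE.le.eventuallyLE
    intro x hx
    rw [Set.mem_uIoc] at hx
    rcases hx with hx | hx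
    · exact ⟨hs'.1.trans_lt hx.1, hx.2.trans hs.2⟩
    · exact ⟨hs.1.trans_lt hx.1, hx.2.trans hs'.2⟩

lemma int_deriv_zero (h : ∀ s, HasDerivAt g (g' s) s) (hc : Continuous g') (hp : g ℓ = g 0) :
    ∫ x in (0:ℝ)..ℓ, g' x = 0 := by
  rw [intervalIntegral.integral_eq_sub_of_hasDerivAt (fun x _ => h x)
    (hc.intervalIntegrable _ _), hp, sub_self]

/-- sup bound for a mean-zero function -/
lemma sup_mean_zero (hℓ : 0 < ℓ) (h : ∀ s, HasDerivAt g (g' s) s) (hc : Continuous g')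
    (h0 : ∫ x in (0:ℝ)..ℓ, g x = 0) {s : ℝ} (hs : s ∈ Set.Icc 0 ℓ) :
    ‖g s‖ ≤ ∫ x in (0:ℝ)..ℓ, ‖g' x‖ := by
  have hgc : Continuous g := continuous_iff_continuousAt.2 fun x => (h x).continuousAt
  have e : ∫ x in (0:ℝ)..ℓ, (g s - g x) = ℓ • g s := by
    rw [intervalIntegral.integral_sub (by simp) (hgc.intervalIntegrable _ _), h0]
    simp
  have := intervalIntegral.norm_integral_le_of_norm_le_const (a := 0) (b := ℓ)
    (f := fun x => g s - g x) (C := ∫ x in (0:ℝ)..ℓ, ‖g' x‖) (by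
      intro x hx
      rw [Set.uIoc_of_le hℓ.le] at hx
      exact osc hℓ h hc hs ⟨hx.1.le, hx.2⟩)
  rw [e, norm_smul, sub_zero, Real.norm_eq_abs, abs_of_pos hℓ] at this
  nlinarith

/-- Agmon type bound -/
lemma sup_agmon (hℓ : 0 < ℓ) (h : ∀ s, HasDerivAt g (g' s) s) (hc : Continuous g')
    {s : ℝ} (hs : s ∈ Set.Icc 0 ℓ) :
    ‖g s‖ ^ 2 ≤ 2 / ℓ * (∫ x in (0:ℝ)..ℓ, ‖g x‖ ^ 2) + 2 * ℓ * ∫ x in (0:ℝ)..ℓ, ‖g' x‖ ^ 2 := by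
  have hgc : Continuous g := continuous_iff_continuousAt.2 fun x => (h x).continuousAt
  set D := ∫ x in (0:ℝ)..ℓ, ‖g' x‖ with hD
  have hcs : D ^ 2 ≤ ℓ * ∫ x in (0:ℝ)..ℓ, ‖g' x‖ ^ 2 := cs_int hc.norm hℓ
  have hm : ∫ x in (0:ℝ)..ℓ, ‖g s‖ ^ 2 ≤ ∫ x in (0:ℝ)..ℓ, (2 * ‖g x‖ ^ 2 + 2 * D ^ 2) := by
    apply intervalIntegral.integral_mono_on hℓ.le (by simp)
      (Continuous.intervalIntegrable (by fun_prop) _ _)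
    intro x hx
    have h1 := osc hℓ h hc hs hx
    have h2 : ‖g s‖ ≤ ‖g x‖ + D := by
      have := norm_sub_norm_le (g s) (g x); linarith
    have h3 : ‖g s‖ ^ 2 ≤ (‖g x‖ + D) ^ 2 := pow_le_pow_left₀ (norm_nonneg _) h2 2
    nlinarith [sq_nonneg (‖g x‖ - D)]
  rw [intervalIntegral.integral_add, intervalIntegral.integral_const_mul] at hm
  · simp only [intervalIntegral.integral_const, sub_zero, smul_eq_mul] at hm
    have : ℓ * ‖g s‖ ^ 2 ≤ ℓ * (2 / ℓ * (∫ x in (0:ℝ)..ℓ, ‖g x‖ ^ 2) +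
        2 * ℓ * ∫ x in (0:ℝ)..ℓ, ‖g' x‖ ^ 2) := by
      have e : ℓ * (2 / ℓ * (∫ x in (0:ℝ)..ℓ, ‖g x‖ ^ 2) +
        2 * ℓ * ∫ x in (0:ℝ)..ℓ, ‖g' x‖ ^ 2) = 2 * (∫ x in (0:ℝ)..ℓ, ‖g x‖ ^ 2) +
        2 * ℓ * (ℓ * ∫ x in (0:ℝ)..ℓ, ‖g' x‖ ^ 2) := by field_simp
      rw [e]; nlinarith
    exact le_of_mul_le_mul_left this hℓ
  all_goals exact Continuous.intervalIntegrable (by fun_prop) _ _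

end oneD

lemma le_of_sq {x y : ℝ} (h : x ^ 2 ≤ y ^ 2) (hy : 0 ≤ y) : x ≤ y := 
  (abs_le_of_sq_le_sq' h hy).2

/-! ### A fixed time slice of a solution -/

@[fun_prop]
lemma Continuous.cross {X : Type*} [TopologicalSpace X] {f g : X → R3} (hf : Continuous f)
    (hg : Continuous g) : Continuous (fun x => cross3 (f x) (g x)) := by
  have h : Continuous fun x => crossL (f x) (g x) := by fun_prop
  exact h

/-- A time slice: `u1, …, u4` are the space derivatives of `u`, `p = ∂ₜu`, `p1 = ∂ₛ∂ₜu`,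
`p2 = ∂ₛₛ∂ₜu`, `q = ∂ₜₜu`. -/
structure Slice (ℓ M : ℝ) (u u1 u2 u3 u4 p p1 p2 q : ℝ → R3) : Prop where
  h0 : ∀ s, HasDerivAt u (u1 s) s
  h1 : ∀ s, HasDerivAt u1 (u2 s) s
  h2 : ∀ s, HasDerivAt u2 (u3 s) s
  h3 : ∀ s, HasDerivAt u3 (u4 s) s
  hp : ∀ s, HasDerivAt p (p1 s) s
  hp1 : ∀ s, HasDerivAt p1 (p2 s) s
  c4 : Continuous u4
  cp2 : Continuous p2
  cq : Continuous q
  per0 : u ℓ = u 0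
  per1 : u1 ℓ = u1 0
  per2 : u2 ℓ = u2 0
  per3 : u3 ℓ = u3 0
  perp : p ℓ = p 0
  perp1 : p1 ℓ = p1 0
  nrm : ∀ s, ‖u s‖ = 1
  pde : ∀ s, p s = cross3 (u s) (u2 s)
  qeq : ∀ s, q s = cross3 (p s) (u2 s) + cross3 (u s) (p2 s)
  m3 : ∫ s in (0:ℝ)..ℓ, ‖u3 s‖ ^ 2 ≤ M ^ 2

lemma cont_of_hasDeriv {f f' : ℝ → R3} (h : ∀ s, HasDerivAt f (f' s) s) : Continuous f :=
  continuous_iff_continuousAt.2 fun x => (h x).continuousAt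

lemma hasDeriv_uniq {E : Type*} [NormedAddCommGroup E] [NormedSpace ℝ E] {f g : ℝ → E}
    {f' g' : E} {s : ℝ} (h : ∀ s, f s = g s) (hf : HasDerivAt f f' s) (hg : HasDerivAt g g' s) :
    f' = g' := by
  have : f = g := funext h
  subst this
  exact hf.unique hg

lemma utt_alg (a b c d e : R3) (haa : inner ℝ a a = 1) (hab : inner ℝ a b = 0)
    (hac : inner ℝ a c = - inner ℝ b b) (had : inner ℝ a d = -3 * inner ℝ b c)
    (hae : inner ℝ a e = -4 * inner ℝ b d - 3 * inner ℝ c c) :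
    cross3 (cross3 a c) c + cross3 a ((cross3 a e + cross3 b d) + (cross3 b d + cross3 c c)) =
      -e - ((4 * (inner ℝ b d + inner ℝ c c)) • a + (6 * inner ℝ b c) • b
        + (inner ℝ b b) • c) := by
  rw [inner3] at haa hab hac had hae
  rw [inner3] at hac had hae
  rw [inner3] at hae
  apply ext3 <;>
    simp only [PiLp.add_apply, PiLp.sub_apply, PiLp.neg_apply, PiLp.smul_apply, smul_eq_mul,
      cross3_0, cross3_1, cross3_2, inner3]
  · linear_combination c 0 * hac + 2 * b 0 * had - 2 * d 0 * hab + a 0 * hae - e 0 * haa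
  · linear_combination c 1 * hac + 2 * b 1 * had - 2 * d 1 * hab + a 1 * hae - e 1 * haa
  · linear_combination c 2 * hac + 2 * b 2 * had - 2 * d 2 * hab + a 2 * hae - e 2 * haa

namespace Slice
variable {ℓ M : ℝ} {u u1 u2 u3 u4 p p1 p2 q : ℝ → R3}

section basic

lemma c0 (H : Slice ℓ M u u1 u2 u3 u4 p p1 p2 q)
    : Continuous u := cont_of_hasDeriv H.h0
lemma c1 (H : Slice ℓ M u u1 u2 u3 u4 p p1 p2 q)
    : Continuous u1 := cont_of_hasDeriv H.h1
lemma c2 (H : Slice ℓ M u u1 u2 u3 u4 p p1 p2 q)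
    : Continuous u2 := cont_of_hasDeriv H.h2
lemma c3 (H : Slice ℓ M u u1 u2 u3 u4 p p1 p2 q)
    : Continuous u3 := cont_of_hasDeriv H.h3
lemma cp (H : Slice ℓ M u u1 u2 u3 u4 p p1 p2 q)
    : Continuous p := cont_of_hasDeriv H.hp
lemma cp1 (H : Slice ℓ M u u1 u2 u3 u4 p p1 p2 q)
    : Continuous p1 := cont_of_hasDeriv H.hp1

lemma i00 (H : Slice ℓ M u u1 u2 u3 u4 p p1 p2 q)
    (s : ℝ) : inner ℝ (u s) (u s) = 1 := by
  rw [real_inner_self_eq_norm_sq, H.nrm]; norm_num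

lemma i01 (H : Slice ℓ M u u1 u2 u3 u4 p p1 p2 q)
    (s : ℝ) : inner ℝ (u s) (u1 s) = 0 := by
  have := hasDeriv_uniq H.i00 ((H.h0 s).inner ℝ (H.h0 s)) (hasDerivAt_const s 1)
  rw [real_inner_comm (u s) (u1 s)] at this
  linarith

lemma i02 (H : Slice ℓ M u u1 u2 u3 u4 p p1 p2 q)
    (s : ℝ) : inner ℝ (u s) (u2 s) = - inner ℝ (u1 s) (u1 s) := by
  have := hasDeriv_uniq H.i01 ((H.h0 s).inner ℝ (H.h1 s)) (hasDerivAt_const s 0)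
  linarith

lemma i03 (H : Slice ℓ M u u1 u2 u3 u4 p p1 p2 q)
    (s : ℝ) : inner ℝ (u s) (u3 s) = -3 * inner ℝ (u1 s) (u2 s) := by
  have := hasDeriv_uniq H.i02 ((H.h0 s).inner ℝ (H.h2 s)) ((H.h1 s).inner ℝ (H.h1 s)).neg
  rw [real_inner_comm (u1 s) (u2 s)] at this
  linarith

lemma i04 (H : Slice ℓ M u u1 u2 u3 u4 p p1 p2 q)
    (s : ℝ) :
    inner ℝ (u s) (u4 s) = -4 * inner ℝ (u1 s) (u3 s) - 3 * inner ℝ (u2 s) (u2 s) := by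
  have := hasDeriv_uniq H.i03 ((H.h0 s).inner ℝ (H.h3 s))
    (((H.h1 s).inner ℝ (H.h2 s)).const_mul (-3))
  linarith

lemma p1eq (H : Slice ℓ M u u1 u2 u3 u4 p p1 p2 q)
    (s : ℝ) : p1 s = cross3 (u s) (u3 s) + cross3 (u1 s) (u2 s) :=
  hasDeriv_uniq H.pde (H.hp s) ((H.h0 s).cross (H.h2 s))

lemma p2eq (H : Slice ℓ M u u1 u2 u3 u4 p p1 p2 q)
    (s : ℝ) : p2 s = (cross3 (u s) (u4 s) + cross3 (u1 s) (u3 s)) +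
    (cross3 (u1 s) (u3 s) + cross3 (u2 s) (u2 s)) :=
  hasDeriv_uniq H.p1eq (H.hp1 s) (((H.h0 s).cross (H.h3 s)).add ((H.h1 s).cross (H.h2 s)))

lemma q_eq (H : Slice ℓ M u u1 u2 u3 u4 p p1 p2 q)
    (s : ℝ) : q s = - u4 s - ((4 * (inner ℝ (u1 s) (u3 s) + inner ℝ (u2 s) (u2 s))) • u s
    + (6 * inner ℝ (u1 s) (u2 s)) • u1 s + (inner ℝ (u1 s) (u1 s)) • u2 s) := by
  rw [H.qeq, H.p2eq, H.pde]
  exact utt_alg _ _ _ _ _ (H.i00 s) (H.i01 s) (H.i02 s) (H.i03 s) (H.i04 s)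

lemma up (H : Slice ℓ M u u1 u2 u3 u4 p p1 p2 q)
    (s : ℝ) : inner ℝ (u s) (p s) = 0 := by
  rw [H.pde, inner3, cross3_0, cross3_1, cross3_2]; ring

lemma int_u3 (H : Slice ℓ M u u1 u2 u3 u4 p p1 p2 q)
    (hℓ : 0 < ℓ) (hM : 0 < M) : ∫ s in (0:ℝ)..ℓ, ‖u3 s‖ ≤ √ℓ * M := by
  have h := cs_int H.c3.norm hℓ
  have h' : (∫ s in (0:ℝ)..ℓ, ‖u3 s‖) ^ 2 ≤ (√ℓ * M) ^ 2 := by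
    rw [mul_pow, Real.sq_sqrt hℓ.le]
    exact h.trans (mul_le_mul_of_nonneg_left H.m3 hℓ.le)
  exact le_of_sq h' (by positivity)

lemma b2 (H : Slice ℓ M u u1 u2 u3 u4 p p1 p2 q)
    (hℓ : 0 < ℓ) (hM : 0 < M) {s : ℝ} (hs : s ∈ Set.Icc 0 ℓ) : ‖u2 s‖ ≤ √ℓ * M :=
  (sup_mean_zero hℓ H.h2 H.c3 (int_deriv_zero H.h1 H.c2 H.per1) hs).trans (H.int_u3 hℓ hM)

lemma b1' (H : Slice ℓ M u u1 u2 u3 u4 p p1 p2 q)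
    (hℓ : 0 < ℓ) {s : ℝ} (hs : s ∈ Set.Icc 0 ℓ) :
    ‖u1 s‖ ≤ ∫ s in (0:ℝ)..ℓ, ‖u2 s‖ :=
  sup_mean_zero hℓ H.h1 H.c2 (int_deriv_zero H.h0 H.c1 H.per0) hs

lemma b1 (H : Slice ℓ M u u1 u2 u3 u4 p p1 p2 q)
    (hℓ : 0 < ℓ) (hM : 0 < M) {s : ℝ} (hs : s ∈ Set.Icc 0 ℓ) :
    ‖u1 s‖ ≤ ℓ * (√ℓ * M) := by
  refine (H.b1' hℓ hs).trans ?_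
  have := intervalIntegral.integral_mono_on (μ := volume) hℓ.le (H.c2.norm.intervalIntegrable 0 ℓ)
    (g := fun _ => √ℓ * M) (continuous_const.intervalIntegrable 0 ℓ) (fun x hx => H.b2 hℓ hM hx)
  rw [intervalIntegral.integral_const] at this
  simpa only [sub_zero, smul_eq_mul] using this

end basic

end Slice


/-! ### Pointwise estimates -/

lemma abs_inner_le {a b : R3} {x y : ℝ} (ha : ‖a‖ ≤ x) (hb : ‖b‖ ≤ y) : |inner ℝ a b| ≤ x * y :=
  (abs_real_inner_le_norm a b).trans
    (mul_le_mul ha hb (norm_nonneg _) ((norm_nonneg _).trans ha))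

/-- key pointwise bound: `|w| |u_ss| ≤ |w_t| + 2 |w_ss| + 2 B |w_s|`. -/
lemma key_pt {u v u1 v1 u2 v2 : R3} {B : ℝ} (hv : ‖v‖ = 1)
    (hu1 : ‖u1‖ ≤ B) (hv1 : ‖v1‖ ≤ B)
    (h2u : inner ℝ u u2 = - inner ℝ u1 u1) (h2v : inner ℝ v v2 = - inner ℝ v1 v1) :
    ‖u - v‖ * ‖u2‖ ≤ ‖cross3 u u2 - cross3 v v2‖ + 2 * ‖u2 - v2‖ + 2 * B * ‖u1 - v1‖ := by
  have e1 : cross3 (u - v) u2 = (cross3 u u2 - cross3 v v2) - cross3 v (u2 - v2) := by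
    apply ext3 <;> simp only [PiLp.sub_apply, cross3_0, cross3_1, cross3_2] <;> ring
  have e2 : inner ℝ (u - v) u2 = - inner ℝ v (u2 - v2) - inner ℝ (u1 - v1) (u1 + v1) := by
    simp only [inner_sub_left, inner_sub_right, inner_add_right]
    rw [real_inner_comm u1 v1]
    linarith
  have n1 : ‖cross3 (u - v) u2‖ ≤ ‖cross3 u u2 - cross3 v v2‖ + ‖u2 - v2‖ := by
    rw [e1]
    refine (norm_sub_le _ _).trans ?_
    have := norm_cross_le v (u2 - v2)
    rw [hv, one_mul] at this
    linarith
  have n2 : |inner ℝ (u - v) u2| ≤ ‖u2 - v2‖ + 2 * B * ‖u1 - v1‖ := by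
    rw [e2]
    have h1 := abs_inner_le (a := v) (b := u2 - v2) hv.le le_rfl
    have h2 := abs_inner_le (a := u1 - v1) (b := u1 + v1) le_rfl
      ((norm_add_le u1 v1).trans (add_le_add hu1 hv1))
    rw [abs_le] at h1 h2 ⊢
    constructor <;> nlinarith [h1.1, h1.2, h2.1, h2.2]
  have lag := cross_lagrange (u - v) u2
  have hA := norm_nonneg (cross3 (u - v) u2)
  have hI := abs_nonneg (inner ℝ (u - v) u2)
  have : ‖u - v‖ * ‖u2‖ ≤ ‖cross3 (u - v) u2‖ + |inner ℝ (u - v) u2| := by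
    apply le_of_sq _ (by positivity)
    rw [mul_pow, ← lag, ← sq_abs (inner ℝ (u - v) u2)]
    nlinarith
  linarith

/-- scalar inequality behind the third estimate -/
lemma scalar3 {a b m θ B κ : ℝ} (hB : 1 ≤ B) (hκ0 : 0 ≤ κ) (hκ : κ ≤ a + 2 * b + 2 * B * θ) :
    8 * (a * (θ * m + B * κ)) + 8 * ((B ^ 2 + m) * (θ * κ + θ * b) + B * θ * (B * θ + B * b))
      + 12 * (a * (B ^ 2 * θ + (B * θ + B * b) * B)) + 2 * (a * (B ^ 2 * b + 2 * B * θ * B))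
      ≤ 220 * B ^ 4 * (a ^ 2 + b ^ 2 + θ ^ 2 * (1 + m ^ 2)) := by
  set Q := a ^ 2 + b ^ 2 + θ ^ 2 * (1 + m ^ 2) with hQ
  have hθm : 0 ≤ θ ^ 2 * m ^ 2 := by positivity
  have qa : a ^ 2 ≤ Q := by nlinarith [sq_nonneg b, sq_nonneg θ]
  have q1 : a ^ 2 + b ^ 2 + θ ^ 2 + θ ^ 2 * m ^ 2 = Q := by rw [hQ]; ring
  have hQ0 : 0 ≤ Q := by positivity
  have B2 : 1 ≤ B ^ 2 := one_le_pow₀ hB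
  have B34 : B ^ 3 ≤ B ^ 4 := pow_le_pow_right₀ hB (by norm_num)
  have B24 : B ^ 2 ≤ B ^ 4 := pow_le_pow_right₀ hB (by norm_num)
  have B4 : 1 ≤ B ^ 4 := one_le_pow₀ hB
  have B13 : B ≤ B ^ 3 := by nlinarith
  have hκ2 : κ ^ 2 ≤ 12 * B ^ 2 * Q := by
    have h1 : κ ^ 2 ≤ (a + 2 * b + 2 * B * θ) ^ 2 := pow_le_pow_left₀ hκ0 hκ 2
    have h2 : (a + 2 * b + 2 * B * θ) ^ 2 ≤ 3 * (a ^ 2 + 4 * b ^ 2 + 4 * (B ^ 2 * θ ^ 2)) := by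
      nlinarith [sq_nonneg (a - 2 * b), sq_nonneg (a - 2 * B * θ), sq_nonneg (2 * b - 2 * B * θ)]
    have h3 : B ^ 2 * (a ^ 2 + b ^ 2 + θ ^ 2) ≤ B ^ 2 * Q :=
      mul_le_mul_of_nonneg_left (by linarith) (by positivity)
    have h4 : a ^ 2 ≤ B ^ 2 * a ^ 2 := by nlinarith [sq_nonneg a]
    have h5 : b ^ 2 ≤ B ^ 2 * b ^ 2 := by nlinarith [sq_nonneg b]
    nlinarith [sq_nonneg a]
  have e12 : B ^ 2 * Q ≤ B ^ 4 * Q := mul_le_mul_of_nonneg_right B24 hQ0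
  have e13 : B ^ 3 * Q ≤ B ^ 4 * Q := mul_le_mul_of_nonneg_right B34 hQ0
  have e14 : Q ≤ B ^ 4 * Q := le_mul_of_one_le_left hQ0 B4
  have tm : ∀ x y : ℝ, 2 * (x * y) ≤ x ^ 2 + y ^ 2 := fun x y => by nlinarith [sq_nonneg (x - y)]
  have a0 := sq_nonneg a
  have b0 := sq_nonneg b
  have θ0 := sq_nonneg θ
  have e02 : Q ≤ B ^ 2 * Q := le_mul_of_one_le_left hQ0 B2
  clear_value Q
  have T1 : 2 * (a * (θ * m)) ≤ Q := by linarith [tm a (θ * m), mul_pow θ m 2]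
  have T2 : 2 * (a * (B * κ)) ≤ 13 * (B ^ 3 * Q) := by
    have : 2 * (a * κ) ≤ 13 * B ^ 2 * Q := by linarith [tm a κ]
    have := mul_le_mul_of_nonneg_left this (by linarith : 0 ≤ B)
    linarith
  have T3 : 2 * (θ * (κ + b)) ≤ 14 * B ^ 2 * Q := by
    linarith [tm θ κ, tm θ b]
  have T3' : 2 * (B ^ 2 * (θ * (κ + b))) ≤ 14 * (B ^ 4 * Q) := by
    have := mul_le_mul_of_nonneg_left T3 (by positivity : 0 ≤ B ^ 2)
    linarith
  have T4 : 2 * (m * θ * (κ + b)) ≤ 14 * (B ^ 2 * Q) := by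
    linarith [tm (m * θ) κ, tm (m * θ) b, mul_pow m θ 2]
  have T5 : B ^ 2 * (θ ^ 2 + θ * b) ≤ B ^ 2 * (2 * Q) := by
    apply mul_le_mul_of_nonneg_left _ (by positivity)
    linarith [tm θ b]
  have T6 : B ^ 2 * (2 * (a * θ) + a * b) ≤ B ^ 2 * (2 * Q) := by
    apply mul_le_mul_of_nonneg_left _ (by positivity)
    linarith [tm a b, tm a θ]
  linarith

/-- vector inequality behind the third estimate -/
lemma vector3 {w w1 w2 wt u1 u2 v1 v2 v3 vt vt1 : R3} {B θ κ : ℝ} (hB : 1 ≤ B)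
    (hu1 : ‖u1‖ ≤ B) (hu2 : ‖u2‖ ≤ B) (hv1 : ‖v1‖ ≤ B) (hv2 : ‖v2‖ ≤ B) (hvt : ‖vt‖ ≤ B)
    (hvt1 : ‖vt1‖ ≤ B ^ 2 + ‖v3‖) (hw1 : ‖w1‖ ≤ θ) (hwv1 : ‖w‖ * ‖v1‖ ≤ θ)
    (hwu2 : ‖w‖ * ‖u2‖ ≤ κ) (hwv2 : ‖w‖ * ‖v2‖ ≤ κ)
    (hκ : κ ≤ ‖wt‖ + 2 * ‖w2‖ + 2 * B * θ) :
    -8 * (inner ℝ wt w * (inner ℝ v1 v3 + inner ℝ v2 v2))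
      - 8 * ((inner ℝ vt1 w + inner ℝ vt w1) * (inner ℝ w1 u2 + inner ℝ v1 w2))
      - 12 * (inner ℝ w1 wt * inner ℝ u1 u2
          + (inner ℝ w1 u2 + inner ℝ v1 w2) * inner ℝ v1 wt)
      - 2 * (inner ℝ w2 wt * inner ℝ u1 u1 + (inner ℝ w1 u1 + inner ℝ v1 w1) * inner ℝ v2 wt)
      ≤ 220 * B ^ 4 * (‖wt‖ ^ 2 + ‖w2‖ ^ 2 + θ ^ 2 * (1 + ‖v3‖ ^ 2)) := by
  have hθ : 0 ≤ θ := (norm_nonneg _).trans hw1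
  have hκ0 : 0 ≤ κ := (mul_nonneg (norm_nonneg _) (norm_nonneg _)).trans hwu2
  have hB0 : 0 ≤ B := by linarith
  refine le_trans ?_ (scalar3 hB hκ0 hκ)
  have P1 : |inner ℝ wt w * (inner ℝ v1 v3 + inner ℝ v2 v2)| ≤
      ‖wt‖ * (θ * ‖v3‖ + B * κ) := by
    rw [abs_mul]
    have x1 := abs_real_inner_le_norm wt w
    have x2 : |inner ℝ v1 v3 + inner ℝ v2 v2| ≤ ‖v1‖ * ‖v3‖ + ‖v2‖ * ‖v2‖ :=
      (abs_add_le _ _).trans (add_le_add (abs_real_inner_le_norm _ _) (abs_real_inner_le_norm _ _))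
    calc _ ≤ (‖wt‖ * ‖w‖) * (‖v1‖ * ‖v3‖ + ‖v2‖ * ‖v2‖) := by gcongr
      _ = ‖wt‖ * ((‖w‖ * ‖v1‖) * ‖v3‖ + ‖v2‖ * (‖w‖ * ‖v2‖)) := by ring
      _ ≤ _ := by gcongr
  have y : |inner ℝ w1 u2 + inner ℝ v1 w2| ≤ ‖w1‖ * ‖u2‖ + ‖v1‖ * ‖w2‖ :=
    (abs_add_le _ _).trans (add_le_add (abs_real_inner_le_norm _ _) (abs_real_inner_le_norm _ _))
  have y' : |inner ℝ w1 u2 + inner ℝ v1 w2| ≤ B * θ + B * ‖w2‖ := by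
    refine y.trans ?_
    rw [mul_comm B θ]; gcongr
  have P2 : |(inner ℝ vt1 w + inner ℝ vt w1) * (inner ℝ w1 u2 + inner ℝ v1 w2)| ≤
      (B ^ 2 + ‖v3‖) * (θ * κ + θ * ‖w2‖) + B * θ * (B * θ + B * ‖w2‖) := by
    rw [add_mul]
    refine (abs_add_le _ _).trans (add_le_add ?_ ?_)
    · rw [abs_mul]
      calc _ ≤ (‖vt1‖ * ‖w‖) * (‖w1‖ * ‖u2‖ + ‖v1‖ * ‖w2‖) := by
            gcongr; exact abs_real_inner_le_norm _ _
        _ = ‖vt1‖ * (‖w1‖ * (‖w‖ * ‖u2‖) + (‖w‖ * ‖v1‖) * ‖w2‖) := by ring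
        _ ≤ _ := by gcongr
    · rw [abs_mul]
      have := abs_inner_le hvt hw1
      gcongr
  have P3 : |inner ℝ w1 wt * inner ℝ u1 u2 + (inner ℝ w1 u2 + inner ℝ v1 w2) * inner ℝ v1 wt| ≤
      ‖wt‖ * (B ^ 2 * θ + (B * θ + B * ‖w2‖) * B) := by
    refine (abs_add_le _ _).trans ?_
    rw [abs_mul, abs_mul]
    have x1 := abs_inner_le (b := wt) hw1 le_rfl
    have x2 := abs_inner_le hu1 hu2
    have x3 := abs_inner_le (b := wt) hv1 le_rfl
    calc _ ≤ (θ * ‖wt‖) * (B * B) + (B * θ + B * ‖w2‖) * (B * ‖wt‖) := by gcongr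
      _ = _ := by ring
  have P4 : |inner ℝ w2 wt * inner ℝ u1 u1 + (inner ℝ w1 u1 + inner ℝ v1 w1) * inner ℝ v2 wt| ≤
      ‖wt‖ * (B ^ 2 * ‖w2‖ + 2 * B * θ * B) := by
    refine (abs_add_le _ _).trans ?_
    rw [abs_mul, abs_mul]
    have x1 := abs_real_inner_le_norm w2 wt
    have x2 := abs_inner_le hu1 hu1
    have x3 := abs_inner_le (b := wt) hv2 le_rfl
    have x4 : |inner ℝ w1 u1 + inner ℝ v1 w1| ≤ θ * B + B * θ :=
      (abs_add_le _ _).trans (add_le_add (abs_inner_le hw1 hu1) (abs_inner_le hv1 hw1))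
    calc _ ≤ (‖w2‖ * ‖wt‖) * (B * B) + (θ * B + B * θ) * (B * ‖wt‖) := by gcongr
      _ = _ := by ring
  have := (abs_le.1 P1).1
  have := (abs_le.1 P2).1
  have := (abs_le.1 P3).1
  have := (abs_le.1 P4).1
  linarith

/-! ### The three integral estimates -/

/-- the constant bounding first and second derivatives -/
def Bc (ℓ M : ℝ) : ℝ := 1 + √ℓ * M + ℓ * (√ℓ * M)

/-- auxiliary constant -/
def Nc (ℓ M : ℝ) : ℝ := √ℓ * (3 * 1 + 2 * Bc ℓ M * ℓ + Bc ℓ M * ℓ ^ 2)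

lemma Bc_ge {ℓ M : ℝ} (hℓ : 0 < ℓ) (hM : 0 < M) : 1 ≤ Bc ℓ M := by
  have : 0 ≤ √ℓ * M := by positivity
  have : 0 ≤ ℓ * (√ℓ * M) := by positivity
  unfold Bc; linarith

lemma int_le_of_deriv {ℓ : ℝ} {G I R S : ℝ → ℝ} (hℓ : 0 < ℓ)
    (hG : ∀ s, HasDerivAt G (I s - R s) s) (hI : Continuous I) (hR : Continuous R)
    (hS : Continuous S) (hper : G ℓ = G 0) (hRS : ∀ s ∈ Set.Icc 0 ℓ, R s ≤ S s) :
    ∫ s in (0:ℝ)..ℓ, I s ≤ ∫ s in (0:ℝ)..ℓ, S s := by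
  have h0 := int_deriv_zero (g := G) (ℓ := ℓ) hG (hI.sub hR) hper
  rw [intervalIntegral.integral_sub (hI.intervalIntegrable _ _) (hR.intervalIntegrable _ _)] at h0
  have := intervalIntegral.integral_mono_on (μ := volume) hℓ.le (hR.intervalIntegrable 0 ℓ)
    (hS.intervalIntegrable 0 ℓ) hRS
  linarith

section two
variable {ℓ M : ℝ} {u u1 u2 u3 u4 p p1 p2 q v v1 v2 v3 v4 r r1 r2 k : ℝ → R3}

lemma est1 (hℓ : 0 < ℓ) (hM : 0 < M) (H : Slice ℓ M u u1 u2 u3 u4 p p1 p2 q)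
    (K : Slice ℓ M v v1 v2 v3 v4 r r1 r2 k) :
    ∫ s in (0:ℝ)..ℓ, 2 * inner ℝ (u s - v s) (p s - r s) ≤
      Bc ℓ M * ((∫ s in (0:ℝ)..ℓ, ‖u s - v s‖ ^ 2) + ∫ s in (0:ℝ)..ℓ, ‖u1 s - v1 s‖ ^ 2) := by
  have hB := Bc_ge hℓ hM
  have cu := H.c0
  have cu1 := H.c1
  have cv := K.c0
  have cv1 := K.c1
  have cp := H.cp
  have cr := K.cp
  rw [← intervalIntegral.integral_add (Continuous.intervalIntegrable (by fun_prop) _ _)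
    (Continuous.intervalIntegrable (by fun_prop) _ _), ← intervalIntegral.integral_const_mul]
  refine int_le_of_deriv hℓ
    (G := fun s => 2 * inner ℝ (u s - v s) (cross3 (u s) (u1 s) - cross3 (v s) (v1 s)))
    (R := fun s => -2 * inner ℝ (u1 s - v1 s) (cross3 (u s - v s) (u1 s))) ?_
    (by fun_prop) (by fun_prop) (by fun_prop) ?_ ?_
  · intro s
    have h := (((H.h0 s).sub (K.h0 s)).inner ℝ
      (((H.h0 s).cross (H.h1 s)).sub ((K.h0 s).cross (K.h1 s)))).const_mul 2
    refine HasDerivAt.congr_deriv h ?_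
    simp only [H.pde, K.pde, inner3, PiLp.sub_apply, PiLp.add_apply, cross3_0, cross3_1, cross3_2,
      Pi.sub_apply]
    ring
  · simp only [H.per0, H.per1, K.per0, K.per1]
  · intro s hs
    have h1 := abs_inner_le (a := u1 s - v1 s) le_rfl (norm_cross_le (u s - v s) (u1 s))
    have h2 : ‖u1 s‖ ≤ Bc ℓ M := by
      have := H.b1 hℓ hM hs
      have : 0 ≤ √ℓ * M := by positivity
      unfold Bc; linarith
    have h3 : ‖u1 s - v1 s‖ * (‖u s - v s‖ * ‖u1 s‖) ≤
        ‖u1 s - v1 s‖ * (‖u s - v s‖ * Bc ℓ M) := by gcongr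
    have h4 := (abs_le.1 h1).1
    have h5 := mul_le_mul_of_nonneg_left (two_mul_le_add_sq (‖u s - v s‖) (‖u1 s - v1 s‖))
      (by linarith : 0 ≤ Bc ℓ M)
    linarith

lemma est2 (hℓ : 0 < ℓ) (H : Slice ℓ M u u1 u2 u3 u4 p p1 p2 q)
    (K : Slice ℓ M v v1 v2 v3 v4 r r1 r2 k) :
    ∫ s in (0:ℝ)..ℓ, 2 * inner ℝ (u1 s - v1 s) (p1 s - r1 s) ≤
      (1 + (2 / ℓ + 2 * ℓ) * M ^ 2) *
      ((∫ s in (0:ℝ)..ℓ, ‖u s - v s‖ ^ 2) + ∫ s in (0:ℝ)..ℓ, ‖u1 s - v1 s‖ ^ 2) := by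
  have cu := H.c0
  have cu1 := H.c1
  have cu2 := H.c2
  have cu3 := H.c3
  have cv := K.c0
  have cv1 := K.c1
  have cp := H.cp1
  have cr := K.cp1
  set A := ∫ s in (0:ℝ)..ℓ, ‖u s - v s‖ ^ 2 with hA
  set D := ∫ s in (0:ℝ)..ℓ, ‖u1 s - v1 s‖ ^ 2 with hD
  have hA0 : 0 ≤ A := intervalIntegral.integral_nonneg hℓ.le fun _ _ => by positivity
  have hD0 : 0 ≤ D := intervalIntegral.integral_nonneg hℓ.le fun _ _ => by positivity
  set W := (2 / ℓ + 2 * ℓ) * (A + D) with hW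
  have hW0 : 0 ≤ W := by positivity
  have hsup : ∀ s ∈ Set.Icc 0 ℓ, ‖u s - v s‖ ^ 2 ≤ W := by
    intro s hs
    have := sup_agmon (g := fun s => u s - v s) (g' := fun s => u1 s - v1 s) hℓ
      (fun s => (H.h0 s).sub (K.h0 s)) (by fun_prop) hs
    rw [← hA, ← hD] at this
    have h1 : 0 ≤ 2 / ℓ * D := by positivity
    have h2 : 0 ≤ 2 * ℓ * A := by positivity
    rw [hW]; linarith
  have main : ∫ s in (0:ℝ)..ℓ, 2 * inner ℝ (u1 s - v1 s) (p1 s - r1 s) ≤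
      ∫ s in (0:ℝ)..ℓ, (‖u1 s - v1 s‖ ^ 2 + W * ‖u3 s‖ ^ 2) := by
    refine int_le_of_deriv hℓ
      (G := fun s => 2 * inner ℝ (u1 s - v1 s) (p s - r s)
        - 2 * inner ℝ (u1 s - v1 s) (cross3 (u s - v s) (u2 s)))
      (R := fun s => 2 * inner ℝ (u1 s - v1 s) (cross3 (u s - v s) (u3 s))) ?_
      (by fun_prop) (by fun_prop) (by fun_prop) ?_ ?_
    · intro s
      have h := ((((H.h1 s).sub (K.h1 s)).inner ℝ ((H.hp s).sub (K.hp s))).const_mul 2).sub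
        ((((H.h1 s).sub (K.h1 s)).inner ℝ
          (((H.h0 s).sub (K.h0 s)).cross (H.h2 s))).const_mul 2)
      refine HasDerivAt.congr_deriv h ?_
      simp only [H.pde, K.pde, inner3, PiLp.sub_apply, PiLp.add_apply, cross3_0, cross3_1,
        cross3_2, Pi.sub_apply]
      ring
    · simp only [H.per0, H.per1, K.per0, K.per1, H.perp, K.perp, H.per2]
    · intro s hs
      have h1 := abs_inner_le (a := u1 s - v1 s) le_rfl (norm_cross_le (u s - v s) (u3 s))
      have h4 := (abs_le.1 h1).2
      have h5 := two_mul_le_add_sq (‖u1 s - v1 s‖) (‖u s - v s‖ * ‖u3 s‖)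
      have h6 : (‖u s - v s‖ * ‖u3 s‖) ^ 2 ≤ W * ‖u3 s‖ ^ 2 := by
        rw [mul_pow]; exact mul_le_mul_of_nonneg_right (hsup s hs) (by positivity)
      linarith
  have split : ∫ s in (0:ℝ)..ℓ, (‖u1 s - v1 s‖ ^ 2 + W * ‖u3 s‖ ^ 2) =
      D + W * ∫ s in (0:ℝ)..ℓ, ‖u3 s‖ ^ 2 := by
    rw [intervalIntegral.integral_add (Continuous.intervalIntegrable (by fun_prop) _ _)
      (Continuous.intervalIntegrable (by fun_prop) _ _), intervalIntegral.integral_const_mul]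
  have := mul_le_mul_of_nonneg_left H.m3 hW0
  have e : (1 + (2 / ℓ + 2 * ℓ) * M ^ 2) * (A + D) = (A + D) + W * M ^ 2 := by rw [hW]; ring
  rw [e]
  linarith

lemma alg3 {u u1 u2 u3 v v1 v2 v3 p r : R3} (hp : inner ℝ u p = 0) (hr : inner ℝ v r = 0) :
    2 * inner ℝ (p - r)
      (((4 * (inner ℝ u1 u3 + inner ℝ u2 u2)) • u + (6 * inner ℝ u1 u2) • u1 +
          (inner ℝ u1 u1) • u2) -
       ((4 * (inner ℝ v1 v3 + inner ℝ v2 v2)) • v + (6 * inner ℝ v1 v2) • v1 +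
          (inner ℝ v1 v1) • v2)) =
      -(8 * (inner ℝ r (u - v)) * ((inner ℝ u1 u3 + inner ℝ u2 u2) -
        (inner ℝ v1 v3 + inner ℝ v2 v2))
      -8 * (inner ℝ (p - r) (u - v) * (inner ℝ v1 v3 + inner ℝ v2 v2))
      - 12 * (inner ℝ (u1 - v1) (p - r) * inner ℝ u1 u2
          + (inner ℝ (u1 - v1) u2 + inner ℝ v1 (u2 - v2)) * inner ℝ v1 (p - r))
      - 2 * (inner ℝ (u2 - v2) (p - r) * inner ℝ u1 u1
        + (inner ℝ (u1 - v1) u1 + inner ℝ v1 (u1 - v1)) * inner ℝ v2 (p - r))) := by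
  simp only [inner_sub_left, inner_sub_right, inner_add_right, inner_smul_right]
  rw [real_inner_comm u p, real_inner_comm v r, real_inner_comm u1 p, real_inner_comm u1 r,
    real_inner_comm u2 p, real_inner_comm u2 r, real_inner_comm v1 p, real_inner_comm v1 r,
    real_inner_comm v2 p, real_inner_comm v2 r, hp, hr]
  ring

end two

section three
variable {ℓ M : ℝ} {u u1 u2 u3 u4 p p1 p2 q v v1 v2 v3 v4 r r1 r2 k : ℝ → R3}

lemma Slice.le_Bc1 (H : Slice ℓ M u u1 u2 u3 u4 p p1 p2 q) (hℓ : 0 < ℓ) (hM : 0 < M) {s : ℝ}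
    (hs : s ∈ Set.Icc 0 ℓ) : ‖u1 s‖ ≤ Bc ℓ M := by
  have := H.b1 hℓ hM hs
  have : 0 ≤ √ℓ * M := by positivity
  unfold Bc; linarith

lemma Slice.le_Bc2 (H : Slice ℓ M u u1 u2 u3 u4 p p1 p2 q) (hℓ : 0 < ℓ) (hM : 0 < M) {s : ℝ}
    (hs : s ∈ Set.Icc 0 ℓ) : ‖u2 s‖ ≤ Bc ℓ M := by
  have := H.b2 hℓ hM hs
  have : 0 ≤ ℓ * (√ℓ * M) := by positivity
  unfold Bc; linarith

/-- the third estimate -/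
lemma est3 (hℓ : 0 < ℓ) (hM : 0 < M) (H : Slice ℓ M u u1 u2 u3 u4 p p1 p2 q)
    (K : Slice ℓ M v v1 v2 v3 v4 r r1 r2 k) :
    (∫ s in (0:ℝ)..ℓ, 2 * inner ℝ (u2 s - v2 s) (p2 s - r2 s)) +
      (∫ s in (0:ℝ)..ℓ, 2 * inner ℝ (p s - r s) (q s - k s)) ≤
      (220 * Bc ℓ M ^ 4 * (1 + Nc ℓ M ^ 2 * (ℓ + M ^ 2))) *
      ((∫ s in (0:ℝ)..ℓ, ‖u2 s - v2 s‖ ^ 2) + ∫ s in (0:ℝ)..ℓ, ‖p s - r s‖ ^ 2) := by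
  have hB := Bc_ge hℓ hM
  set B := Bc ℓ M with hBdef
  have hB0 : 0 ≤ B := by linarith
  have cu := H.c0
  have cu1 := H.c1
  have cu2 := H.c2
  have cu3 := H.c3
  have cu4 := H.c4
  have cv := K.c0
  have cv1 := K.c1
  have cv2 := K.c2
  have cv3 := K.c3
  have cv4 := K.c4
  have cp := H.cp
  have cp1 := H.cp1
  have cp2 := H.cp2
  have cq := H.cq
  have cr := K.cp
  have cr1 := K.cp1
  have cr2 := K.cp2
  have ck := K.cq
  set A := ∫ s in (0:ℝ)..ℓ, ‖u2 s - v2 s‖ ^ 2 with hA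
  set D := ∫ s in (0:ℝ)..ℓ, ‖p s - r s‖ ^ 2 with hD
  have hA0 : 0 ≤ A := intervalIntegral.integral_nonneg hℓ.le fun _ _ => by positivity
  have hD0 : 0 ≤ D := intervalIntegral.integral_nonneg hℓ.le fun _ _ => by positivity
  set e := √(A + D) with he
  have he0 : 0 ≤ e := Real.sqrt_nonneg _
  have he2 : e ^ 2 = A + D := Real.sq_sqrt (by positivity)
  have hl0 : 0 ≤ √ℓ := Real.sqrt_nonneg _
  have int2 : ∫ s in (0:ℝ)..ℓ, ‖u2 s - v2 s‖ ≤ √ℓ * e := by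
    apply le_of_sq _ (by positivity)
    rw [mul_pow, Real.sq_sqrt hℓ.le, he2]
    refine (cs_int (by fun_prop) hℓ).trans (mul_le_mul_of_nonneg_left ?_ hℓ.le)
    rw [← hA]; linarith
  have intp : ∫ s in (0:ℝ)..ℓ, ‖p s - r s‖ ≤ √ℓ * e := by
    apply le_of_sq _ (by positivity)
    rw [mul_pow, Real.sq_sqrt hℓ.le, he2]
    refine (cs_int (by fun_prop) hℓ).trans (mul_le_mul_of_nonneg_left ?_ hℓ.le)
    rw [← hD]; linarith
  have sup1 : ∀ s ∈ Set.Icc 0 ℓ, ‖u1 s - v1 s‖ ≤ √ℓ * e := by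
    intro s hs
    refine le_trans ?_ int2
    exact sup_mean_zero (g := fun s => u1 s - v1 s) hℓ (fun s => (H.h1 s).sub (K.h1 s))
      (by fun_prop) (int_deriv_zero (g := fun s => u s - v s)
        (fun s => (H.h0 s).sub (K.h0 s)) (by fun_prop) (by simp only [H.per0, K.per0])) hs
  have osc0 : ∀ s ∈ Set.Icc 0 ℓ, ∀ s' ∈ Set.Icc 0 ℓ,
      ‖u s - v s‖ ≤ ‖u s' - v s'‖ + ℓ * (√ℓ * e) := by
    intro s hs s' hs'
    have h1 := osc (g := fun s => u s - v s) hℓ (fun s => (H.h0 s).sub (K.h0 s))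
      (by fun_prop) hs hs'
    have h2 : ∫ x in (0:ℝ)..ℓ, ‖u1 x - v1 x‖ ≤ ∫ x in (0:ℝ)..ℓ, (√ℓ * e) :=
      intervalIntegral.integral_mono_on (μ := volume) hℓ.le
        (Continuous.intervalIntegrable (by fun_prop) _ _)
        (Continuous.intervalIntegrable (by fun_prop) _ _) sup1
    rw [intervalIntegral.integral_const, sub_zero, smul_eq_mul] at h2
    have h3 := norm_sub_norm_le (u s - v s) (u s' - v s')
    have h4 := h1.trans h2
    linarith
  -- pointwise key bounds
  have keyu : ∀ s ∈ Set.Icc 0 ℓ, ‖u s - v s‖ * ‖u2 s‖ ≤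
      ‖p s - r s‖ + 2 * ‖u2 s - v2 s‖ + 2 * B * ‖u1 s - v1 s‖ := by
    intro s hs
    rw [H.pde, K.pde]
    exact key_pt (K.nrm s) (H.le_Bc1 hℓ hM hs) (K.le_Bc1 hℓ hM hs) (H.i02 s) (K.i02 s)
  have keyv : ∀ s ∈ Set.Icc 0 ℓ, ‖u s - v s‖ * ‖v2 s‖ ≤
      ‖p s - r s‖ + 2 * ‖u2 s - v2 s‖ + 2 * B * ‖u1 s - v1 s‖ := by
    intro s hs
    rw [H.pde, K.pde, norm_sub_rev (u s), norm_sub_rev (u2 s), norm_sub_rev (u1 s),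
      norm_sub_rev (cross3 (u s) (u2 s))]
    exact key_pt (H.nrm s) (K.le_Bc1 hℓ hM hs) (H.le_Bc1 hℓ hM hs) (K.i02 s) (H.i02 s)
  set N := Nc ℓ M with hN
  have hNl : √ℓ ≤ N := by
    rw [hN]; unfold Nc
    rw [← hBdef]
    have : 0 ≤ 2 * B * ℓ + B * ℓ ^ 2 := by positivity
    nlinarith
  have hN0 : 0 ≤ N := hl0.trans hNl
  have supwv : ∀ s ∈ Set.Icc 0 ℓ, ‖u s - v s‖ * ‖v1 s‖ ≤ N * e := by
    intro s hs
    have h1 : ‖u s - v s‖ * ‖v1 s‖ ≤ ∫ x in (0:ℝ)..ℓ, ‖u s - v s‖ * ‖v2 x‖ := by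
      rw [intervalIntegral.integral_const_mul]
      exact mul_le_mul_of_nonneg_left (K.b1' hℓ hs) (norm_nonneg _)
    have h2 : ∫ x in (0:ℝ)..ℓ, ‖u s - v s‖ * ‖v2 x‖ ≤
        ∫ x in (0:ℝ)..ℓ, ((‖p x - r x‖ + 2 * ‖u2 x - v2 x‖) +
          (2 * B * (√ℓ * e) + ℓ * (√ℓ * e) * B)) := by
      apply intervalIntegral.integral_mono_on (μ := volume) hℓ.le
        (Continuous.intervalIntegrable (by fun_prop) _ _)
        (Continuous.intervalIntegrable (by fun_prop) _ _)
      intro x hx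
      have k1 := keyv x hx
      have k2 := mul_le_mul_of_nonneg_right (osc0 s hs x hx) (norm_nonneg (v2 x))
      have k3 := mul_le_mul_of_nonneg_left (K.le_Bc2 hℓ hM hx)
        (by positivity : 0 ≤ ℓ * (√ℓ * e))
      have k4 := mul_le_mul_of_nonneg_left (sup1 x hx) (by positivity : 0 ≤ 2 * B)
      rw [← hBdef] at k3
      linarith
    rw [intervalIntegral.integral_add (Continuous.intervalIntegrable (by fun_prop) _ _)
      (Continuous.intervalIntegrable (by fun_prop) _ _),
      intervalIntegral.integral_add (Continuous.intervalIntegrable (by fun_prop) _ _)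
      (Continuous.intervalIntegrable (by fun_prop) _ _), intervalIntegral.integral_const_mul 2,
      intervalIntegral.integral_const, sub_zero, smul_eq_mul] at h2
    have eN : N * e = 3 * (√ℓ * e) + ℓ * (2 * B * (√ℓ * e) + ℓ * (√ℓ * e) * B) := by
      rw [hN]; unfold Nc; rw [← hBdef]; ring
    rw [eN]
    linarith
  -- the main computation
  have main : ∫ s in (0:ℝ)..ℓ, (2 * inner ℝ (u2 s - v2 s) (p2 s - r2 s) +
      2 * inner ℝ (p s - r s) (q s - k s)) ≤
      ∫ s in (0:ℝ)..ℓ, 220 * B ^ 4 * (‖p s - r s‖ ^ 2 + ‖u2 s - v2 s‖ ^ 2 +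
        (N * e) ^ 2 * (1 + ‖v3 s‖ ^ 2)) := by
    refine int_le_of_deriv hℓ
      (G := fun s => (2 * inner ℝ (u2 s - v2 s) (p1 s - r1 s)
        - 2 * inner ℝ (u3 s - v3 s) (p s - r s))
        + 8 * (inner ℝ (r s) (u s - v s) * (inner ℝ (u1 s) (u2 s) - inner ℝ (v1 s) (v2 s))))
      (R := fun s => -8 * (inner ℝ (p s - r s) (u s - v s) *
          (inner ℝ (v1 s) (v3 s) + inner ℝ (v2 s) (v2 s)))
        - 8 * ((inner ℝ (r1 s) (u s - v s) + inner ℝ (r s) (u1 s - v1 s)) *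
          (inner ℝ (u1 s - v1 s) (u2 s) + inner ℝ (v1 s) (u2 s - v2 s)))
        - 12 * (inner ℝ (u1 s - v1 s) (p s - r s) * inner ℝ (u1 s) (u2 s)
          + (inner ℝ (u1 s - v1 s) (u2 s) + inner ℝ (v1 s) (u2 s - v2 s)) *
            inner ℝ (v1 s) (p s - r s))
        - 2 * (inner ℝ (u2 s - v2 s) (p s - r s) * inner ℝ (u1 s) (u1 s)
          + (inner ℝ (u1 s - v1 s) (u1 s) + inner ℝ (v1 s) (u1 s - v1 s)) *
            inner ℝ (v2 s) (p s - r s))) ?_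
      (by fun_prop) (by fun_prop) (by fun_prop) ?_ ?_
    · intro s
      have h := (((((H.h2 s).sub (K.h2 s)).inner ℝ ((H.hp1 s).sub (K.hp1 s))).const_mul 2).sub
        ((((H.h3 s).sub (K.h3 s)).inner ℝ ((H.hp s).sub (K.hp s))).const_mul 2)).add
        (((((K.hp s).inner ℝ ((H.h0 s).sub (K.h0 s)))).mul
          (((H.h1 s).inner ℝ (H.h2 s)).sub ((K.h1 s).inner ℝ (K.h2 s)))).const_mul 8)
      refine HasDerivAt.congr_deriv h ?_
      simp only [Pi.sub_apply]
      have hqk : inner ℝ (p s - r s) (q s - k s) = - inner ℝ (u4 s - v4 s) (p s - r s)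
          - inner ℝ (p s - r s) (
            ((4 * (inner ℝ (u1 s) (u3 s) + inner ℝ (u2 s) (u2 s))) • u s
              + (6 * inner ℝ (u1 s) (u2 s)) • u1 s + (inner ℝ (u1 s) (u1 s)) • u2 s) -
            ((4 * (inner ℝ (v1 s) (v3 s) + inner ℝ (v2 s) (v2 s))) • v s
              + (6 * inner ℝ (v1 s) (v2 s)) • v1 s + (inner ℝ (v1 s) (v1 s)) • v2 s)) := by
        rw [H.q_eq, K.q_eq, real_inner_comm (p s - r s) (u4 s - v4 s), ← inner_neg_right,
          ← inner_sub_right]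
        congr 1
        abel
      have ha := alg3 (u1 := u1 s) (u2 := u2 s) (u3 := u3 s) (v1 := v1 s) (v2 := v2 s)
        (v3 := v3 s) (H.up s) (K.up s)
      have e1 : inner ℝ (u1 s - v1 s) (u2 s) + inner ℝ (v1 s) (u2 s - v2 s) =
          inner ℝ (u1 s) (u2 s) - inner ℝ (v1 s) (v2 s) := by
        simp only [inner_sub_left, inner_sub_right]; ring
      rw [hqk]
      rw [e1] at ha ⊢
      linear_combination ha
    · simp only [H.per0, H.per1, K.per0, K.per1, H.perp, K.perp, H.per2, K.per2, H.per3, K.per3,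
        H.perp1, K.perp1]
    · intro s hs
      have hθ : ‖u1 s - v1 s‖ ≤ N * e :=
        (sup1 s hs).trans (mul_le_mul_of_nonneg_right hNl he0)
      refine vector3 (κ := ‖p s - r s‖ + 2 * ‖u2 s - v2 s‖ + 2 * B * ‖u1 s - v1 s‖) hB
        (H.le_Bc1 hℓ hM hs) (H.le_Bc2 hℓ hM hs) (K.le_Bc1 hℓ hM hs)
        (K.le_Bc2 hℓ hM hs) ?_ ?_ hθ (supwv s hs) (keyu s hs) (keyv s hs) ?_
      · rw [K.pde]
        refine (norm_cross_le _ _).trans ?_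
        rw [K.nrm, one_mul]
        exact K.le_Bc2 hℓ hM hs
      · rw [K.p1eq]
        refine (norm_add_le _ _).trans ?_
        have h1 := norm_cross_le (v s) (v3 s)
        rw [K.nrm, one_mul] at h1
        have h2 := (norm_cross_le (v1 s) (v2 s)).trans
          (mul_le_mul (K.le_Bc1 hℓ hM hs) (K.le_Bc2 hℓ hM hs) (norm_nonneg _) hB0)
        rw [← hBdef] at h2
        nlinarith
      · have := mul_le_mul_of_nonneg_left hθ (by positivity : 0 ≤ 2 * B)
        linarith
  have lhs : ∫ s in (0:ℝ)..ℓ, (2 * inner ℝ (u2 s - v2 s) (p2 s - r2 s) +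
      2 * inner ℝ (p s - r s) (q s - k s)) =
      (∫ s in (0:ℝ)..ℓ, 2 * inner ℝ (u2 s - v2 s) (p2 s - r2 s)) +
      (∫ s in (0:ℝ)..ℓ, 2 * inner ℝ (p s - r s) (q s - k s)) :=
    intervalIntegral.integral_add (Continuous.intervalIntegrable (by fun_prop) _ _)
      (Continuous.intervalIntegrable (by fun_prop) _ _)
  have rhs : ∫ s in (0:ℝ)..ℓ, 220 * B ^ 4 * (‖p s - r s‖ ^ 2 + ‖u2 s - v2 s‖ ^ 2 +
        (N * e) ^ 2 * (1 + ‖v3 s‖ ^ 2)) =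
      220 * B ^ 4 * (D + A + (N * e) ^ 2 * (ℓ + ∫ s in (0:ℝ)..ℓ, ‖v3 s‖ ^ 2)) := by
    rw [intervalIntegral.integral_const_mul,
      intervalIntegral.integral_add (Continuous.intervalIntegrable (by fun_prop) _ _)
      (Continuous.intervalIntegrable (by fun_prop) _ _),
      intervalIntegral.integral_add (Continuous.intervalIntegrable (by fun_prop) _ _)
      (Continuous.intervalIntegrable (by fun_prop) _ _), intervalIntegral.integral_const_mul,
      intervalIntegral.integral_add (Continuous.intervalIntegrable (by fun_prop) _ _)
      (Continuous.intervalIntegrable (by fun_prop) _ _), intervalIntegral.integral_const,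
      sub_zero, smul_eq_mul, mul_one]
  rw [lhs, rhs] at main
  refine main.trans ?_
  rw [mul_assoc (220 * B ^ 4)]
  apply mul_le_mul_of_nonneg_left _ (by positivity)
  have hm := mul_le_mul_of_nonneg_left K.m3 (by positivity : 0 ≤ (N * e) ^ 2)
  have e3 : (N * e) ^ 2 = N ^ 2 * (A + D) := by rw [mul_pow, he2]
  rw [e3] at hm ⊢
  linarith

end three

/-! ### Assembling -/

lemma leibniz_sq {f : ℝ → ℝ → R3} (hf : Sm f) (ℓ t : ℝ) :
    HasDerivAt (fun τ => ∫ s in (0:ℝ)..ℓ, ‖f τ s‖ ^ 2)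
      (∫ s in (0:ℝ)..ℓ, 2 * inner ℝ (f t s) (dT f t s)) t := by
  have hg : Sm (fun τ s => ‖f τ s‖ ^ 2) := ContDiff.norm_sq ℝ hf
  have h := leibniz hg ℓ t
  have e : (fun s => dT (fun τ s => ‖f τ s‖ ^ 2) t s) =
      fun s => 2 * inner ℝ (f t s) (dT f t s) := by
    funext s
    exact ((hf.hT t s).norm_sq).deriv
  simpa only [e] using h

lemma dT_sub {f g : ℝ → ℝ → R3} (hf : Sm f) (hg : Sm g) (t s : ℝ) :
    dT (fun t s => f t s - g t s) t s = dT f t s - dT g t s :=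
  ((hf.hT t s).sub (hg.hT t s)).deriv

lemma slice_of_sol {ℓ M : ℝ} (hM : 0 < M) {u : ℝ → ℝ → R3} (hu : Sm u)
    (hper : ∀ t s : ℝ, u t (s + ℓ) = u t s) (hn : ∀ t s : ℝ, ‖u t s‖ = 1)
    (pde : ∀ t s : ℝ, deriv (fun τ => u τ s) t =
            deriv (fun σ => cross3 (u t σ) (deriv (u t) σ)) s) (t : ℝ)
    (hb : Real.sqrt (∫ s in (0:ℝ)..ℓ, ‖deriv (deriv (deriv (u t))) s‖ ^ 2) ≤ M) :
    Slice ℓ M (u t) (dS u t) (dS (dS u) t) (dS (dS (dS u)) t) (dS (dS (dS (dS u))) t)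
      (dT u t) (dT (dS u) t) (dT (dS (dS u)) t) (dT (dT u) t) := by
  have cs : ∀ a : R3, cross3 a a = 0 := by
    intro a
    apply ext3 <;> simp only [cross3_0, cross3_1, cross3_2, PiLp.zero_apply] <;> ring
  have pde' : ∀ t s, dT u t s = cross3 (u t s) (dS (dS u) t s) := by
    intro t s
    have h := ((hu.hS t s).cross (hu.dS.hS t s)).deriv
    rw [cs, add_zero] at h
    exact (pde t s).trans h
  have c1 : dT (dS u) = dS (dT u) := hu.comm
  have c2 : dT (dS (dS u)) = dS (dS (dT u)) := by rw [hu.dS.comm, c1]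
  have z : ∀ {f : ℝ → ℝ → R3}, (∀ t s, f t (s + ℓ) = f t s) → f t ℓ = f t 0 := by
    intro f h
    have := h t 0
    rwa [zero_add] at this
  have P1 := per_dS hper
  have P2 := per_dS P1
  have P3 := per_dS P2
  have Pt := per_dT hper
  exact
  { h0 := hu.hS t
    h1 := hu.dS.hS t
    h2 := hu.dS.dS.hS t
    h3 := hu.dS.dS.dS.hS t
    hp := by rw [c1]; exact hu.dT.hS t
    hp1 := by rw [c1, c2]; exact hu.dT.dS.hS t
    c4 := hu.dS.dS.dS.dS.cont t
    cp2 := hu.dS.dS.dT.cont t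
    cq := hu.dT.dT.cont t
    per0 := z hper
    per1 := z P1
    per2 := z P2
    per3 := z P3
    perp := z Pt
    perp1 := z (per_dT P1)
    nrm := hn t
    pde := pde' t
    qeq := by
      intro s
      have h := ((hu.hT t s).cross (hu.dS.dS.hT t s)).deriv
      have e : (fun τ => dT u τ s) = fun τ => cross3 (u τ s) (dS (dS u) τ s) := by
        funext τ; exact pde' τ s
      have : dT (dT u) t s = deriv (fun τ => dT u τ s) t := rfl
      rw [this, e, h, add_comm]
    m3 := by
      have := (Real.sqrt_le_left hM.le).1 hb
      exact this }

/-- Lemma A.5: differential inequalities for the difference of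
two Schrödinger maps. -/
theorem stmt18
    (ℓ M : ℝ) (hℓ : 0 < ℓ) (hM : 0 < M) :
    ∃ C : ℝ, 0 < C ∧
      ∀ u v : ℝ → ℝ → R3,
        ContDiff ℝ (⊤ : ℕ∞) (fun p : ℝ × ℝ => u p.1 p.2) →
        ContDiff ℝ (⊤ : ℕ∞) (fun p : ℝ × ℝ => v p.1 p.2) →
        (∀ t s : ℝ, u t (s + ℓ) = u t s) →
        (∀ t s : ℝ, v t (s + ℓ) = v t s) →
        (∀ t s : ℝ, ‖u t s‖ = 1) →
        (∀ t s : ℝ, ‖v t s‖ = 1) →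
        (∀ t s : ℝ,
          deriv (fun τ => u τ s) t =
            deriv (fun σ => cross3 (u t σ) (deriv (u t) σ)) s) →
        (∀ t s : ℝ,
          deriv (fun τ => v τ s) t =
            deriv (fun σ => cross3 (v t σ) (deriv (v t) σ)) s) →
        ∀ t : ℝ,
          Real.sqrt (∫ s in (0:ℝ)..ℓ, ‖deriv (deriv (deriv (u t))) s‖ ^ 2) ≤ M →
          Real.sqrt (∫ s in (0:ℝ)..ℓ, ‖deriv (deriv (deriv (v t))) s‖ ^ 2) ≤ M →
          (deriv (fun τ => ∫ s in (0:ℝ)..ℓ, ‖u τ s - v τ s‖ ^ 2) t ≤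
            C * ((∫ s in (0:ℝ)..ℓ, ‖u t s - v t s‖ ^ 2)
              + ∫ s in (0:ℝ)..ℓ, ‖deriv (u t) s - deriv (v t) s‖ ^ 2)) ∧
          (deriv (fun τ => ∫ s in (0:ℝ)..ℓ, ‖deriv (u τ) s - deriv (v τ) s‖ ^ 2) t ≤
            C * ((∫ s in (0:ℝ)..ℓ, ‖u t s - v t s‖ ^ 2)
              + ∫ s in (0:ℝ)..ℓ, ‖deriv (u t) s - deriv (v t) s‖ ^ 2)) ∧
          (deriv (fun τ =>
              (∫ s in (0:ℝ)..ℓ, ‖deriv (deriv (u τ)) s - deriv (deriv (v τ)) s‖ ^ 2)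
                + ∫ s in (0:ℝ)..ℓ,
                    ‖deriv (fun τ' => u τ' s) τ - deriv (fun τ' => v τ' s) τ‖ ^ 2) t ≤
            C * ((∫ s in (0:ℝ)..ℓ, ‖deriv (deriv (u t)) s - deriv (deriv (v t)) s‖ ^ 2)
              + ∫ s in (0:ℝ)..ℓ,
                  ‖deriv (fun τ => u τ s) t - deriv (fun τ => v τ s) t‖ ^ 2)) := by
  have hB := Bc_ge hℓ hM
  refine ⟨Bc ℓ M + (1 + (2 / ℓ + 2 * ℓ) * M ^ 2) +
    (220 * Bc ℓ M ^ 4 * (1 + Nc ℓ M ^ 2 * (ℓ + M ^ 2))), by positivity, ?_⟩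
  intro u v hu hv peru perv nu nv pdeu pdev t hbu hbv
  have hu : Sm u := hu
  have hv : Sm v := hv
  have H := slice_of_sol hM hu peru nu pdeu t hbu
  have K := slice_of_sol hM hv perv nv pdev t hbv
  have n1 : 0 ≤ Bc ℓ M := by linarith
  have n2 : 0 ≤ 1 + (2 / ℓ + 2 * ℓ) * M ^ 2 := by positivity
  have n3 : 0 ≤ 220 * Bc ℓ M ^ 4 * (1 + Nc ℓ M ^ 2 * (ℓ + M ^ 2)) := by positivity
  have nn : ∀ f g : ℝ → R3, 0 ≤ ∫ s in (0:ℝ)..ℓ, ‖f s - g s‖ ^ 2 := fun f g =>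
    intervalIntegral.integral_nonneg hℓ.le fun _ _ => by positivity
  have d0 := leibniz_sq (hu.sub hv) ℓ t
  have d1 := leibniz_sq (hu.dS.sub hv.dS) ℓ t
  have d2 := leibniz_sq (hu.dS.dS.sub hv.dS.dS) ℓ t
  have d3 := leibniz_sq (hu.dT.sub hv.dT) ℓ t
  simp only [dT_sub hu hv] at d0
  simp only [dT_sub hu.dS hv.dS] at d1
  simp only [dT_sub hu.dS.dS hv.dS.dS] at d2
  simp only [dT_sub hu.dT hv.dT] at d3
  have E1 := est1 hℓ hM H K
  have E2 := est2 hℓ H K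
  have E3 := est3 hℓ hM H K
  refine ⟨?_, ?_, ?_⟩
  · refine (d0.deriv.trans_le E1).trans ?_
    refine mul_le_mul_of_nonneg_right (by linarith) (add_nonneg (nn _ _) (nn _ _))
  · refine (d1.deriv.trans_le E2).trans ?_
    refine mul_le_mul_of_nonneg_right (by linarith) (add_nonneg (nn _ _) (nn _ _))
  · refine ((d2.add d3).deriv.trans_le E3).trans ?_
    refine mul_le_mul_of_nonneg_right (by linarith) (add_nonneg (nn _ _) (nn _ _))
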